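/- Penalized likelihood identity for noise injection in generalized linear models (exact part of Lemma 1): for every weight vector w ∈ ℝ^p, if each noise vector eᵢ has coordinatewise mean zero and the random variable A((xᵢ + eᵢ)·w) is integrable for each i, then E_e[ Σ_{i=1}^n ℓ(w | xᵢ + eᵢ, yᵢ) ] = Σ_{i=1}^n ℓ(w | xᵢ, yᵢ) + R(w)/d, where R(w) = Σ_{i=1}^n ( E_e[A((xᵢ + eᵢ)·w)] − A(xᵢ·w) ). -/

import Mathlib

open MeasureTheory

/-- Negative log-likelihood contribution of one case in a generalized linear model:
`ℓ(w | x, y) = −(T(y)·(x·w) − A(x·w))/d + c`. -/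
noncomputable def glmLoss {p : ℕ} (A T : ℝ → ℝ) (d c : ℝ) (w x : Fin p → ℝ) (y : ℝ) : ℝ :=
  -(T y * (∑ j, x j * w j) - A (∑ j, x j * w j)) / d + c

/-- A centred perturbation of a vector does not change the expectation of a linear functional. -/
theorem integral_sum_add_mul_of_integral_eq_zero {Ω ι : Type*} [Fintype ι] [MeasurableSpace Ω]
    {μ : Measure Ω} [IsProbabilityMeasure μ] (x w : ι → ℝ) {e : Ω → ι → ℝ}
    (hint : ∀ j, Integrable (fun ω => e ω j) μ) (hmean : ∀ j, (∫ ω, e ω j ∂μ) = 0) :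
    (∫ ω, ∑ j, (x j + e ω j) * w j ∂μ) = ∑ j, x j * w j := by
  have hterm : ∀ j, Integrable (fun ω => (x j + e ω j) * w j) μ := fun j =>
    ((integrable_const _).add (hint j)).mul_const _
  rw [integral_finsetSum _ fun j _ => hterm j]
  refine Finset.sum_congr rfl fun j _ => ?_
  rw [integral_mul_const, integral_add (integrable_const _) (hint j), hmean j]
  simp

/-- **Penalized likelihood identity for noise injection in GLMs (exact part of Lemma 1).**
If each noise vector has coordinatewise mean zero and `A((xᵢ + eᵢ)·w)` is integrable, then the
noise-expectation of the perturbed negative log-likelihood equals the unperturbed negative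
log-likelihood plus `R(w)/d`, where
`R(w) = Σᵢ (E[A((xᵢ + eᵢ)·w)] − A(xᵢ·w))`. -/
theorem glm_penalized_likelihood
    {Ω : Type*} [MeasurableSpace Ω] (μ : Measure Ω) [IsProbabilityMeasure μ]
    (n p : ℕ) (A T : ℝ → ℝ) (d : ℝ) (hd : 0 < d) (c : Fin n → ℝ)
    (x : Fin n → Fin p → ℝ) (y : Fin n → ℝ) (w : Fin p → ℝ)
    (e : Fin n → Ω → Fin p → ℝ)
    (hint : ∀ i j, Integrable (fun ω => e i ω j) μ)
    (hmean : ∀ i j, (∫ ω, e i ω j ∂μ) = 0)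
    (hA : ∀ i, Integrable (fun ω => A (∑ j, (x i j + e i ω j) * w j)) μ) :
    (∫ ω, ∑ i, glmLoss A T d (c i) w (fun j => x i j + e i ω j) (y i) ∂μ)
      = (∑ i, glmLoss A T d (c i) w (x i) (y i))
        + (∑ i, ((∫ ω, A (∑ j, (x i j + e i ω j) * w j) ∂μ)
            - A (∑ j, x i j * w j))) / d := by
  have hlin : ∀ i, Integrable (fun ω => ∑ j, (x i j + e i ω j) * w j) μ := fun i =>
    integrable_finsetSum _ fun j _ => ((integrable_const _).add (hint i j)).mul_const _
  have hdiff : ∀ i, Integrable (fun ω => -(T (y i) * (∑ j, (x i j + e i ω j) * w j)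
      - A (∑ j, (x i j + e i ω j) * w j)) / d) μ := fun i =>
    (((hlin i).const_mul _).sub (hA i)).neg.div_const d
  have hloss : ∀ i, Integrable
      (fun ω => glmLoss A T d (c i) w (fun j => x i j + e i ω j) (y i)) μ := fun i =>
    (hdiff i).add (integrable_const (c i))
  rw [integral_finsetSum _ fun i _ => hloss i, Finset.sum_div,
    ← Finset.sum_add_distrib]
  refine Finset.sum_congr rfl fun i _ => ?_
  simp only [glmLoss]
  rw [integral_add (hdiff i) (integrable_const _), integral_div, integral_neg,
    integral_sub ((hlin i).const_mul _) (hA i), integral_const_mul,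
    integral_sum_add_mul_of_integral_eq_zero (x i) w (hint i) (hmean i)]
  simp only [integral_const, probReal_univ, one_smul]
  ring
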